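/- For all n, m ≥ 1, the number of Schröder paths of semilength n with exactly n−m diagonal steps, none of which lies on the diagonal, satisfies (n+1)·|SP⁺(n,m)| = binom(n+m, m)·binom(n−1, m−1); that is, |SP⁺(n,m)| equals the number of (n−m)-dimensional faces of the (n−1)-dimensional associahedron. -/

import Mathlib

/-! Schröder paths -/

inductive SStep : Type
  | H | V | D
deriving DecidableEq

def SStep.dx : SStep → ℕ
  | .H => 1 | .V => 0 | .D => 1

def SStep.dy : SStep → ℕ
  | .H => 0 | .V => 1 | .D => 1

def pathX (p : List SStep) : ℕ := (p.map SStep.dx).sum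
def pathY (p : List SStep) : ℕ := (p.map SStep.dy).sum

/-- A Schröder path of semilength `n`: from (0,0) to (n,n), steps H,V,D,
never rising above the diagonal. -/
def IsSchroder (n : ℕ) (p : List SStep) : Prop :=
  pathX p = n ∧ pathY p = n ∧ ∀ q : List SStep, q <+: p → pathY q ≤ pathX q

/-- No diagonal step starts on the diagonal. -/
def DiagFree (p : List SStep) : Prop :=
  ∀ q r : List SStep, p = q ++ SStep.D :: r → pathX q ≠ pathY q

/-- Every diagonal step is immediately followed by a horizontal step,
except if it is the last step. -/
def DFollowedByH (p : List SStep) : Prop :=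
  ∀ q r : List SStep, p = q ++ SStep.D :: r → r = [] ∨ ∃ r' : List SStep, r = SStep.H :: r'

def SP (n m : ℕ) : Type := {p : List SStep // IsSchroder n p ∧ p.count SStep.D + m = n}
def SPplus (n m : ℕ) : Type :=
  {p : List SStep // IsSchroder n p ∧ p.count SStep.D + m = n ∧ DiagFree p}
def SPzero (n m : ℕ) : Type :=
  {p : List SStep // IsSchroder n p ∧ p.count SStep.D + m = n ∧ ¬ DiagFree p}
def RP (n m : ℕ) : Type :=
  {p : List SStep // IsSchroder n p ∧ p.count SStep.D + m = n ∧ DFollowedByH p}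

/-! Rooted planar trees -/

inductive PTree : Type
  | node : List PTree → PTree

namespace PTree

def leaves : PTree → ℕ
  | node [] => 1
  | node (c :: cs) => ((c :: cs).attach.map fun x => leaves x.1).sum
decreasing_by
  have := List.sizeOf_lt_of_mem x.2
  simp only [PTree.node.sizeOf_spec, List.cons.sizeOf_spec] at this ⊢
  omega

def internal : PTree → ℕ
  | node [] => 0
  | node (c :: cs) => 1 + ((c :: cs).attach.map fun x => internal x.1).sum
decreasing_by
  have := List.sizeOf_lt_of_mem x.2
  simp only [PTree.node.sizeOf_spec, List.cons.sizeOf_spec] at this ⊢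
  omega

def Good : PTree → Prop
  | node cs => cs.length ≠ 1 ∧ ∀ c ∈ cs.attach, Good c.1
decreasing_by
  have := List.sizeOf_lt_of_mem c.2
  simp only [PTree.node.sizeOf_spec] at this ⊢
  omega

end PTree

def PT (n m : ℕ) : Type :=
  {t : PTree // t.Good ∧ t.leaves = n + 1 ∧ t.internal = m}

def PTn (n : ℕ) : Type := {t : PTree // t.Good ∧ t.leaves = n + 1}

/-! Motzkin paths -/

inductive MStep : Type
  | U | H | D
deriving DecidableEq

def MStep.dh : MStep → ℤ
  | .U => 1 | .H => 0 | .D => -1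

def mHeight (p : List MStep) : ℤ := (p.map MStep.dh).sum

def IsMotzkin (k : ℕ) (p : List MStep) : Prop :=
  p.length = k ∧ mHeight p = 0 ∧ ∀ q : List MStep, q <+: p → 0 ≤ mHeight q

def HFollowedByU (p : List MStep) : Prop :=
  ∀ q r : List MStep, p = q ++ MStep.H :: r → r = [] ∨ ∃ r' : List MStep, r = MStep.U :: r'

def MP (k : ℕ) : Type := {p : List MStep // IsMotzkin k p}
def RMP (k : ℕ) : Type := {p : List MStep // IsMotzkin k p ∧ HFollowedByU p}

/-- Motzkin steps with two possible colors on up and horizontal steps. -/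
inductive CMStep : Type
  | U : Bool → CMStep
  | H : Bool → CMStep
  | D : CMStep
deriving DecidableEq

def CMStep.forget : CMStep → MStep
  | .U _ => .U | .H _ => .H | .D => .D

/-- (h,u)-colored Motzkin paths of length n-1. -/
def huMP (n : ℕ) : Type := {p : List CMStep // IsMotzkin (n - 1) (p.map CMStep.forget)}

/-- A path staying weakly below the diagonal, without diagonal steps on the diagonal. -/
def IsSubdiagonal (p : List SStep) : Prop :=
  (∀ q : List SStep, q <+: p → pathY q ≤ pathX q) ∧ DiagFree p

/-- The subdiagonal paths ending at `(x, y)` with exactly `d` diagonal steps. -/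
def subdiagonalPaths (x y d : ℕ) : Set (List SStep) :=
  {p | pathX p = x ∧ pathY p = y ∧ p.count SStep.D = d ∧ IsSubdiagonal p}

@[simp] lemma pathX_concat (p : List SStep) (s : SStep) : pathX (p ++ [s]) = pathX p + s.dx := by
  simp [pathX]

@[simp] lemma pathY_concat (p : List SStep) (s : SStep) : pathY (p ++ [s]) = pathY p + s.dy := by
  simp [pathY]

lemma diagFree_concat (p : List SStep) (s : SStep) :
    DiagFree (p ++ [s]) ↔ DiagFree p ∧ (s = SStep.D → pathX p ≠ pathY p) := by
  constructor
  · intro h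
    refine ⟨fun q r hqr => h q (r ++ [s]) (by simp [hqr]), ?_⟩
    rintro rfl
    exact h p [] rfl
  · rintro ⟨h₁, h₂⟩ q r hqr
    rcases List.eq_nil_or_concat r with rfl | ⟨r, t, rfl⟩
    · obtain ⟨rfl, hs⟩ := List.append_inj' hqr rfl
      exact h₂ (by simpa using hs)
    · rw [List.concat_eq_append, ← List.cons_append, ← List.append_assoc] at hqr
      exact h₁ q r (List.append_inj' hqr rfl).1

lemma isSubdiagonal_concat (p : List SStep) (s : SStep) :
    IsSubdiagonal (p ++ [s]) ↔
      IsSubdiagonal p ∧ pathY p + s.dy ≤ pathX p + s.dx ∧ (s = SStep.D → pathX p ≠ pathY p) := by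
  have h : (∀ q : List SStep, q <+: p ++ [s] → pathY q ≤ pathX q) ↔
      (∀ q : List SStep, q <+: p → pathY q ≤ pathX q) ∧ pathY p + s.dy ≤ pathX p + s.dx := by
    simp only [List.prefix_concat_iff, or_imp, forall_and, forall_eq]
    simp [and_comm]
  rw [IsSubdiagonal, IsSubdiagonal, h, diagFree_concat]
  tauto

lemma isSubdiagonal_nil : IsSubdiagonal [] := by
  refine ⟨?_, ?_⟩
  · simp [pathX, pathY]
  · intro q r h
    simp at h

lemma IsSubdiagonal.pathY_le_pathX {p : List SStep} (hp : IsSubdiagonal p) :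
    pathY p ≤ pathX p :=
  hp.1 p (List.prefix_refl p)

lemma concat_injective (s : SStep) : Function.Injective (fun p : List SStep => p ++ [s]) :=
  fun _ _ h => (List.append_inj' h rfl).1

lemma encard_image_concat (s : SStep) (A : Set (List SStep)) :
    ((fun p => p ++ [s]) '' A).encard = A.encard :=
  (concat_injective s).encard_image A

lemma disjoint_image_concat {s t : SStep} (h : s ≠ t) (A B : Set (List SStep)) :
    Disjoint ((fun p => p ++ [s]) '' A) ((fun p => p ++ [t]) '' B) := by
  rw [Set.disjoint_left]
  rintro _ ⟨p, -, rfl⟩ ⟨q, -, hq⟩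
  have := (List.append_inj' hq rfl).2
  exact h (by simpa using this.symm)

lemma subdiagonalPaths_zero_zero (d : ℕ) :
    subdiagonalPaths 0 0 d = if d = 0 then {[]} else ∅ := by
  ext p
  rcases List.eq_nil_or_concat p with rfl | ⟨p, s, rfl⟩
  · split_ifs with h <;> simp [subdiagonalPaths, isSubdiagonal_nil, pathX, pathY, h, eq_comm]
  · split_ifs <;> cases s <;> simp [subdiagonalPaths, SStep.dx, SStep.dy]

lemma subdiagonalPaths_succ_zero (x d : ℕ) :
    subdiagonalPaths (x + 1) 0 d = (fun p => p ++ [SStep.H]) '' subdiagonalPaths x 0 d := by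
  ext p
  rcases List.eq_nil_or_concat p with rfl | ⟨p, s, rfl⟩
  · simp [subdiagonalPaths, pathX]
  · cases s <;>
      simp [subdiagonalPaths, SStep.dx, SStep.dy, isSubdiagonal_concat]
    all_goals grind

lemma subdiagonalPaths_diagonal (x d : ℕ) :
    subdiagonalPaths (x + 1) (x + 1) d =
      (fun p => p ++ [SStep.V]) '' subdiagonalPaths (x + 1) x d := by
  ext p
  rcases List.eq_nil_or_concat p with rfl | ⟨p, s, rfl⟩
  · simp [subdiagonalPaths, pathX]
  · have := @IsSubdiagonal.pathY_le_pathX p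
    cases s <;>
      simp [subdiagonalPaths, SStep.dx, SStep.dy, isSubdiagonal_concat]
    all_goals grind

lemma subdiagonalPaths_succ_succ_zero {x y : ℕ} (h : y < x) :
    subdiagonalPaths (x + 1) (y + 1) 0 =
      (fun p => p ++ [SStep.H]) '' subdiagonalPaths x (y + 1) 0 ∪
        (fun p => p ++ [SStep.V]) '' subdiagonalPaths (x + 1) y 0 := by
  ext p
  rcases List.eq_nil_or_concat p with rfl | ⟨p, s, rfl⟩
  · simp [subdiagonalPaths, pathX]
  · cases s <;>
      simp [subdiagonalPaths, SStep.dx, SStep.dy, isSubdiagonal_concat]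
    all_goals grind

lemma subdiagonalPaths_succ_succ_succ {x y : ℕ} (h : y < x) (d : ℕ) :
    subdiagonalPaths (x + 1) (y + 1) (d + 1) =
      (fun p => p ++ [SStep.H]) '' subdiagonalPaths x (y + 1) (d + 1) ∪
        (fun p => p ++ [SStep.V]) '' subdiagonalPaths (x + 1) y (d + 1) ∪
          (fun p => p ++ [SStep.D]) '' subdiagonalPaths x y d := by
  ext p
  rcases List.eq_nil_or_concat p with rfl | ⟨p, s, rfl⟩
  · simp [subdiagonalPaths, pathX]
  · cases s <;>
      simp [subdiagonalPaths, SStep.dx, SStep.dy, isSubdiagonal_concat]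
    all_goals grind

lemma choose_mul_choose_diagonal (x d : ℕ) :
    x.choose d * (2 * x + 1 - d).choose x = (x + 1).choose d * (2 * x + 1 - d).choose (x + 1) := by
  rcases Nat.lt_or_ge x d with h | h
  · rw [Nat.choose_eq_zero_of_lt h, Nat.choose_eq_zero_of_lt (n := 2 * x + 1 - d) (k := x + 1) (by omega)]
    simp
  · obtain ⟨e, rfl⟩ := Nat.exists_eq_add_of_le h
    have h₁ := Nat.choose_succ_right_eq (2 * (d + e) + 1 - d) (d + e)
    have h₂ := Nat.choose_mul_succ_eq (d + e) d
    rw [show 2 * (d + e) + 1 - d - (d + e) = e + 1 by omega] at h₁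
    rw [show d + e + 1 - d = e + 1 by omega] at h₂
    apply Nat.eq_of_mul_eq_mul_right (show 0 < d + e + 1 by omega)
    calc _ = ((d + e).choose d * (d + e + 1)) * (2 * (d + e) + 1 - d).choose (d + e) := by ring
      _ = (d + e + 1).choose d * ((2 * (d + e) + 1 - d).choose (d + e) * (e + 1)) := by
        rw [h₂]; ring
      _ = _ := by rw [← h₁]; ring

/-- The number of subdiagonal paths ending at `(x, y)` with `d` diagonal steps is
`(x-1).choose d * (x+y-d).choose x - x.choose d * (x+y-d).choose (x+1)`. -/
theorem exists_encard_subdiagonalPaths {x y : ℕ} (hyx : y ≤ x) (d : ℕ) :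
    ∃ k : ℕ, (subdiagonalPaths x y d).encard = k ∧
      k + x.choose d * (x + y - d).choose (x + 1) = (x - 1).choose d * (x + y - d).choose x := by
  match x, y with
  | 0, 0 =>
    rw [subdiagonalPaths_zero_zero]
    rcases d with - | d
    · exact ⟨1, by simp⟩
    · exact ⟨0, by simp⟩
  | x + 1, 0 =>
    obtain ⟨k, hk, hk'⟩ := exists_encard_subdiagonalPaths (Nat.zero_le x) d
    refine ⟨k, by rw [subdiagonalPaths_succ_zero, encard_image_concat, hk], ?_⟩
    rw [Nat.choose_eq_zero_of_lt (n := x + 0 - d) (by omega)] at hk'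
    rw [Nat.choose_eq_zero_of_lt (n := x + 1 + 0 - d) (by omega)]
    rcases d with - | d
    · simpa using hk'
    · rw [Nat.choose_eq_zero_of_lt (n := x + 1 + 0 - (d + 1)) (by omega)]
      rcases x with - | x
      · simpa using hk'
      · rw [Nat.choose_eq_zero_of_lt (n := x + 1 + 0 - (d + 1)) (by omega)] at hk'
        simpa using hk'
  | x + 1, y + 1 =>
    rcases (Nat.le_of_succ_le_succ hyx).eq_or_lt with rfl | hlt
    · obtain ⟨k, hk, hk'⟩ := exists_encard_subdiagonalPaths (Nat.le_succ y) d
      refine ⟨k, by rw [subdiagonalPaths_diagonal, encard_image_concat, hk], ?_⟩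
      rcases Nat.lt_or_ge (2 * y + 1) d with hd | hd
      · rw [show y + 1 + (y + 1) - d = y + 1 + y - d by omega]
        exact hk'
      · have := choose_mul_choose_diagonal y d
        rw [show y + 1 + (y + 1) - d = (2 * y + 1 - d) + 1 by omega, Nat.choose_succ_succ,
          Nat.choose_succ_succ _ y]
        rw [show y.succ + y - d = 2 * y + 1 - d by omega] at hk'
        simp only [Nat.succ_eq_add_one, Nat.add_sub_cancel] at *
        linarith
    · obtain ⟨x, rfl⟩ := Nat.exists_eq_add_of_lt (Nat.zero_lt_of_lt hlt)
      simp only [Nat.zero_add] at *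
      obtain ⟨k₁, hk₁, hk₁'⟩ := exists_encard_subdiagonalPaths (x := x + 1) (y := y + 1) hlt d
      obtain ⟨k₂, hk₂, hk₂'⟩ :=
        exists_encard_subdiagonalPaths (x := x + 1 + 1) (y := y) (by omega) d
      rcases d with - | d
      · refine ⟨k₁ + k₂, ?_, ?_⟩
        · rw [subdiagonalPaths_succ_succ_zero hlt,
            Set.encard_union_eq (disjoint_image_concat (by decide) _ _), encard_image_concat,
            encard_image_concat, hk₁, hk₂]
          rfl
        · simp only [Nat.sub_zero, Nat.choose_zero_right, one_mul] at *
          rw [show x + 1 + 1 + (y + 1) = (x + 1 + (y + 1)) + 1 by omega, Nat.choose_succ_succ,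
            Nat.choose_succ_succ _ (x + 1)]
          rw [show x + 1 + 1 + y = x + 1 + (y + 1) by omega] at hk₂'
          simp only [Nat.succ_eq_add_one] at *
          linarith
      · obtain ⟨k₃, hk₃, hk₃'⟩ :=
          exists_encard_subdiagonalPaths (x := x + 1) (y := y) (by omega) d
        refine ⟨k₁ + k₂ + k₃, ?_, ?_⟩
        · rw [subdiagonalPaths_succ_succ_succ hlt, Set.encard_union_eq, Set.encard_union_eq,
            encard_image_concat, encard_image_concat, encard_image_concat, hk₁, hk₂, hk₃]
          · rfl
          · exact disjoint_image_concat (by decide) _ _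
          · exact (disjoint_image_concat (by decide) _ _).union_left
              (disjoint_image_concat (by decide) _ _)
        · rw [show x + 1 + (y + 1) - (d + 1) = x + 1 + y - d by omega] at hk₁'
          rw [show x + 1 + 1 + y - (d + 1) = x + 1 + y - d by omega] at hk₂'
          simp only [Nat.add_sub_cancel] at *
          rw [Nat.choose_succ_succ x d, Nat.choose_succ_succ (x + 1) d]
          rw [Nat.choose_succ_succ x d, Nat.choose_succ_succ (x + 1) d] at hk₂'
          rcases Nat.lt_or_ge (x + 1 + y) d with hd | hd
          · rw [Nat.choose_eq_zero_of_lt (n := x) (k := d) (by omega),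
              Nat.choose_eq_zero_of_lt (n := x) (k := d + 1) (by omega),
              Nat.choose_eq_zero_of_lt (n := x + 1) (k := d) (by omega),
              Nat.choose_eq_zero_of_lt (n := x + 1) (k := d + 1) (by omega)] at *
            simp at *
            omega
          · rw [show x + 1 + 1 + (y + 1) - (d + 1) = (x + 1 + y - d) + 1 by omega,
              Nat.choose_succ_succ _ (x + 1), Nat.choose_succ_succ _ (x + 1 + 1)]
            simp only [Nat.succ_eq_add_one] at *
            linarith
termination_by x + y

lemma card_SPplus (n m : ℕ) (h : m ≤ n) :
    Nat.card (SPplus n m) = (subdiagonalPaths n n (n - m)).ncard := by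
  rw [← Nat.card_coe_set_eq]
  refine Nat.card_congr (Equiv.subtypeEquivRight fun p => ?_)
  simp only [IsSchroder, subdiagonalPaths, IsSubdiagonal, Set.mem_ofPred_eq]
  have : p.count SStep.D + m = n ↔ p.count SStep.D = n - m := by omega
  tauto

/-- (n+1)·|SP⁺(n,m)| = binom(n+m,m)·binom(n−1,m−1). -/
theorem statement13 (n m : ℕ) (hn : 1 ≤ n) (hm : 1 ≤ m) :
    (n + 1) * Nat.card (SPplus n m) = (n + m).choose m * (n - 1).choose (m - 1) := by
  rcases Nat.lt_or_ge n m with h | h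
  · have : IsEmpty (SPplus n m) := ⟨fun ⟨p, hp⟩ => by omega⟩
    rw [Nat.card_of_isEmpty, Nat.choose_eq_zero_of_lt (n := n - 1) (by omega)]
    rfl
  · obtain ⟨k, hk, hk'⟩ := exists_encard_subdiagonalPaths (le_refl n) (n - m)
    rw [card_SPplus n m h, Set.ncard, hk, ENat.toNat_natCast]
    rw [show n + n - (n - m) = n + m by omega, Nat.choose_symm h,
      Nat.choose_symm_of_eq_add (show n - 1 = (n - m) + (m - 1) by omega),
      Nat.choose_symm_of_eq_add (show n + m = n + m from rfl)] at hk'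
    have h₁ : (n + m).choose (n + 1) * (n + 1) = (n + m).choose m * m := by
      rw [Nat.choose_succ_right_eq, Nat.choose_symm_add, Nat.add_sub_cancel_left]
    have h₂ : n * (n - 1).choose (m - 1) = n.choose m * m := by
      obtain ⟨n, rfl⟩ := Nat.exists_eq_add_of_le' hn
      obtain ⟨m, rfl⟩ := Nat.exists_eq_add_of_le' hm
      exact Nat.add_one_mul_choose_eq n m
    have h₃ : n.choose m * (n + m).choose (n + 1) * (n + 1) =
        n * ((n - 1).choose (m - 1) * (n + m).choose m) := by
      rw [mul_assoc, h₁, ← mul_assoc n, h₂]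
      ring
    have h₄ := congrArg (· * (n + 1)) hk'
    simp only [add_mul _ _ (n + 1), h₃] at h₄
    linarith
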